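/- arXiv:math/9807062 — 2 statements merged into one kernel-verified Lean document; each statement's English description precedes it below -/
import Mathlib

section
/- The measure μ is concentrated on the set S: μ(S) = 1, where S = {x ∈ K̄ : ‖T_n(x)‖ ≤ q_n^{d_n/m_n}·‖m_n‖ for all n ≥ 1}. -/
open MeasureTheory Module
open scoped Classical

noncomputable section

/-- The topology defined by a translation-invariant "norm" function via open balls. -/
def normTopology {X : Type} [Sub X] (f : X → ℝ) : TopologicalSpace X :=
  TopologicalSpace.generateFrom
    {U | ∃ x : X, ∃ ε : ℝ, 0 < ε ∧ U = {y : X | f (y - x) < ε}}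

variable (p : ℕ) [Fact (Nat.Prime p)]
variable (k : Type) [Field k] [Algebra ℚ_[p] k] [FiniteDimensional ℚ_[p] k]

/-- The normalized absolute value on the local field k. -/
def absk (x : k) : ℝ := ‖(Algebra.norm ℚ_[p] x : ℚ_[p])‖

/-- The topology of k as a local field. -/
def kTop : TopologicalSpace k := normTopology (absk p k)

variable (K : Type) [Field K] [Algebra k K] [CharZero K]
variable (Kn : ℕ → IntermediateField k K)

/-- The relative trace map between two intermediate fields. -/
def relTrace (E F : IntermediateField k K) (h : E ≤ F) (x : F) : E :=
  (@Algebra.trace E F _ _ (IntermediateField.inclusion h).toRingHom.toAlgebra) x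

variable (T : ℕ → K →ₗ[k] K)

/-- The projective limit K̄ of the fields Kₙ along the normalized trace maps. -/
def ProjLim : Type :=
  {x : ℕ → K // (∀ n, x n ∈ Kn n) ∧ ∀ ⦃n ν : ℕ⦄, n ≤ ν → T n (x ν) = x n}

/-- Pointwise addition on K̄. -/
def pladd (x y : ProjLim k K Kn T) : ProjLim k K Kn T :=
  ⟨fun n => x.1 n + y.1 n, by
    refine ⟨fun n => add_mem (x.2.1 n) (y.2.1 n), ?_⟩
    intro n ν h
    simp [map_add, x.2.2 h, y.2.2 h]⟩

/-- Pointwise scalar multiplication on K̄. -/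
def plsmul (c : k) (x : ProjLim k K Kn T) : ProjLim k K Kn T :=
  ⟨fun n => c • x.1 n, by
    refine ⟨fun n => (Kn n).toSubalgebra.smul_mem (x.2.1 n) c, ?_⟩
    intro n ν h
    simp [_root_.map_smul, x.2.2 h]⟩

/-- The topology on K̄ given by the seminorms x ↦ ‖xₙ‖. -/
def projTop (Knorm : K → ℝ) : TopologicalSpace (ProjLim k K Kn T) :=
  TopologicalSpace.generateFrom
    {U | ∃ x : ProjLim k K Kn T, ∃ n : ℕ, ∃ ε : ℝ, 0 < ε ∧
          U = {y : ProjLim k K Kn T | Knorm (y.1 n - x.1 n) < ε}}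

/-- The Borel σ-algebra of the seminorm topology on K̄. -/
def projMeas (Knorm : K → ℝ) : MeasurableSpace (ProjLim k K Kn T) :=
  @borel _ (projTop k K Kn T Knorm)

/-- The topology on Kₙ induced from the absolute value ‖·‖. -/
def KnTop (Knorm : K → ℝ) (n : ℕ) : TopologicalSpace (Kn n) :=
  TopologicalSpace.induced Subtype.val (normTopology Knorm)

/-- The Borel σ-algebra of Kₙ. -/
def KnMeas (Knorm : K → ℝ) (n : ℕ) : MeasurableSpace (Kn n) :=
  @borel _ (KnTop k K Kn Knorm n)

/-- The canonical embedding of K into K̄. -/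
def emb (hTmem : ∀ n x, T n x ∈ Kn n)
    (hTproj : ∀ ⦃n ν : ℕ⦄, n ≤ ν → ∀ x : K, T n (T ν x) = T n x) (x : K) :
    ProjLim k K Kn T :=
  ⟨fun n => T n x, fun n => hTmem n x, fun n ν h => hTproj h x⟩

/-- The weak topology σ(K̄, K) on K̄. -/
def weakTop (pairing : K → ProjLim k K Kn T → k) : TopologicalSpace (ProjLim k K Kn T) :=
  ⨅ a : K, TopologicalSpace.induced (pairing a) (kTop p k)

/-- Non-archimedean seminorms on K over k. -/
def IsNASeminorm (f : K → ℝ) : Prop :=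
  (∀ x, 0 ≤ f x) ∧ (∀ x y, f (x + y) ≤ max (f x) (f y)) ∧
    ∀ (c : k) (x : K), f (c • x) = absk p k c * f x

/-- The locally convex topology determined by a family of seminorms. -/
def seminormFamilyTop (F : Set (K → ℝ)) : TopologicalSpace K :=
  TopologicalSpace.generateFrom
    {U | ∃ f ∈ F, ∃ x : K, ∃ ε : ℝ, 0 < ε ∧ U = {y : K | f (y - x) < ε}}

/-- The inductive limit topology on K: the finest locally convex topology over k
making all the inclusions Kₙ → K continuous. -/
def indTop (Knorm : K → ℝ) : TopologicalSpace K :=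
  sInf {t : TopologicalSpace K |
    (∃ F : Set (K → ℝ), (∀ f ∈ F, IsNASeminorm p k K f) ∧ t = seminormFamilyTop K F) ∧
    ∀ n : ℕ, @Continuous _ _ (KnTop k K Kn Knorm n) t Subtype.val}

/-- Locally constant functions with bounded (hence compact) support on Kₙ. -/
def IsTestFun (Knorm : K → ℝ) (n : ℕ) (φ : Kn n → ℂ) : Prop :=
  @IsLocallyConstant _ _ (KnTop k K Kn Knorm n) φ ∧
    ∃ R : ℝ, ∀ ξ : Kn n, R < Knorm ↑ξ → φ ξ = 0


/-- The fractional differentiation operator Dᵅ applied to the cylindrical function φ ∘ Tₙ. -/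
def Dop (Knorm : K → ℝ) (χ : k → ℂ) (pairing : K → ProjLim k K Kn T → k)
    (vol : ∀ n : ℕ, @MeasureTheory.Measure (Kn n) (KnMeas k K Kn Knorm n))
    (μ : @MeasureTheory.Measure (ProjLim k K Kn T) (projMeas k K Kn T Knorm))
    (α : ℝ) (n : ℕ) (φ : Kn n → ℂ) (x : ProjLim k K Kn T) : ℂ :=
  ∫ ξ : Kn n,
    χ ((finrank k (Kn n) : k)⁻¹ *
        Algebra.trace k (Kn n) (-(⟨x.1 n, x.2.1 n⟩ * ξ))) *
      (if 1 < Knorm ↑ξ then ((Knorm ↑ξ ^ α : ℝ) : ℂ) else 0) *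
      (∫ y, χ (pairing (↑ξ) y) * φ ⟨y.1 n, y.2.1 n⟩ ∂μ) ∂(vol n)
end

section Helpers

variable (p : ℕ) [Fact (Nat.Prime p)]
variable (k : Type) [Field k] [Algebra ℚ_[p] k]

lemma absk_nonneg (x : k) : 0 ≤ absk p k x := norm_nonneg _

lemma absk_mul (x y : k) : absk p k (x * y) = absk p k x * absk p k y := by
  simp [absk]

lemma absk_pow (x : k) (n : ℕ) : absk p k (x ^ n) = absk p k x ^ n := by
  simp [absk]

variable [FiniteDimensional ℚ_[p] k]

lemma absk_zero : absk p k 0 = 0 := by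
  simp [absk]

lemma absk_inv (x : k) : absk p k x⁻¹ = (absk p k x)⁻¹ := by
  rcases eq_or_ne x 0 with rfl | hx
  · simp [absk_zero]
  · refine eq_inv_of_mul_eq_one_left ?_
    rw [← absk_mul, inv_mul_cancel₀ hx]
    simp [absk]

lemma absk_linearMap_continuous {ι : Type} [Fintype ι] (f : (ι → ℚ_[p]) →ₗ[ℚ_[p]] k) :
    Continuous fun t => absk p k (f t) := by
  have hlin : Continuous ((Algebra.leftMulMatrix (finBasis ℚ_[p] k)).toLinearMap ∘ₗ f) :=
    LinearMap.continuous_on_pi _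
  have hdet : Continuous fun t => Algebra.norm ℚ_[p] (f t) := by
    simp_rw [Algebra.norm_eq_matrix_det (finBasis ℚ_[p] k)]
    exact hlin.matrix_det
  exact hdet.norm

/-- Any subset of a finite-dimensional space over a local field contains a countable subset that
approximates it with respect to every linear functional. -/
lemma exists_countable_approx {V : Type} [AddCommGroup V] [Module k V] [FiniteDimensional k V]
    (S : Set V) :
    ∃ D ⊆ S, D.Countable ∧
      ∀ (f : V →ₗ[k] k), ∀ b ∈ S, ∃ c ∈ D, absk p k (f (b - c)) ≤ 1 := by
  let _ : Module ℚ_[p] V := Module.compHom V (algebraMap ℚ_[p] k)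
  have : IsScalarTower ℚ_[p] k V :=
    ⟨fun a b v => by
      rw [Algebra.smul_def, mul_smul]
      rfl⟩
  have : FiniteDimensional ℚ_[p] V := Module.Finite.trans k V
  let e := (finBasis ℚ_[p] V).equivFun
  obtain ⟨D, hDS, hDc, hD⟩ :=
    (TopologicalSpace.IsSeparable.of_separableSpace (e '' S)).exists_countable_dense_subset
  refine ⟨e.symm '' D, ?_, hDc.image _, ?_⟩
  · rintro _ ⟨t, ht, rfl⟩
    obtain ⟨v, hv, rfl⟩ := hDS ht
    simpa using hv
  · intro f b hb
    let g := f.restrictScalars ℚ_[p] ∘ₗ e.symm.toLinearMap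
    have hcont : Continuous fun t => absk p k (g (e b - t)) :=
      (absk_linearMap_continuous p k g).comp (continuous_const.sub continuous_id)
    have hopen := hcont.isOpen_preimage _ (isOpen_Iio (a := (1 : ℝ)))
    obtain ⟨t, ht, htD⟩ := mem_closure_iff.mp (hD ⟨b, hb, rfl⟩) _ hopen
      (by simp [absk_zero])
    refine ⟨e.symm t, ⟨t, htD, rfl⟩, ?_⟩
    have : absk p k (g (e b - t)) < 1 := ht
    simpa [g] using this.le

end Helpers

/-- A function of modulus one with mean one is almost everywhere equal to one. -/
lemma ae_eq_one_of_integral_eq_one {X : Type*} {_ : MeasurableSpace X} {μ : Measure X}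
    [IsProbabilityMeasure μ] {f : X → ℂ} (hf : ∀ x, ‖f x‖ = 1) (hint : ∫ x, f x ∂μ = 1) :
    ∀ᵐ x ∂μ, f x = 1 := by
  have hi : Integrable f μ := by
    by_contra h
    simp [integral_undef h] at hint
  have hir : Integrable (fun x => (f x).re) μ := hi.re
  have hre : ∫ x, (1 - (f x).re) ∂μ = 0 := by
    have h1 : ∫ x, (f x).re ∂μ = 1 := by
      have := integral_re hi
      simp only [RCLike.re_to_complex] at this
      rw [this, hint, Complex.one_re]
    rw [integral_sub (integrable_const _) hir]
    simp [h1]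
  have hnonneg : ∀ x, 0 ≤ 1 - (f x).re := fun x =>
    sub_nonneg.mpr ((Complex.re_le_norm _).trans (hf x).le)
  have hae := (integral_eq_zero_iff_of_nonneg hnonneg ((integrable_const _).sub hir)).mp hre
  filter_upwards [hae] with x hx
  have hr : (f x).re = 1 := by
    exact (sub_eq_zero.mp hx).symm
  have hn : (f x).re ^ 2 + (f x).im ^ 2 = 1 := by
    have := Complex.sq_norm (f x)
    rw [hf x, Complex.normSq_apply] at this
    linarith
  have him : (f x).im = 0 := by
    rw [hr] at hn
    simpa using hn
  exact Complex.ext hr him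

theorem statement_9
    (p : ℕ) [Fact (Nat.Prime p)]
    (k : Type) [Field k] [Algebra ℚ_[p] k] [FiniteDimensional ℚ_[p] k]
    (K : Type) [Field K] [Algebra k K] [CharZero K]
    (Kn : ℕ → IntermediateField k K)
    (hbot : Kn 1 = ⊥) (hmono : Monotone Kn)
    [hfd : ∀ n, FiniteDimensional k (Kn n)]
    (hunion : ∀ x : K, ∃ n, x ∈ Kn n)
    (T : ℕ → K →ₗ[k] K)
    (hTmem : ∀ (n : ℕ) (x : K), T n x ∈ Kn n)
    (hTdef : ∀ (n ν : ℕ) (h : n ≤ ν) (x : K) (hx : x ∈ Kn ν),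
      T n x = ((finrank k (Kn n) : K) / (finrank k (Kn ν) : K)) *
        (relTrace k K (Kn n) (Kn ν) (hmono h) ⟨x, hx⟩ : K))
    (Knorm : K → ℝ)
    (hKnorm : ∀ (n : ℕ) (x : K) (hx : x ∈ Kn n),
      Knorm x = absk p k (Algebra.norm k (⟨x, hx⟩ : Kn n)) ^ ((finrank k (Kn n) : ℝ)⁻¹))
    (pairing : K → ProjLim k K Kn T → k)
    (hpair : ∀ (n : ℕ) (a : K) (ha : a ∈ Kn n) (x : ProjLim k K Kn T),
      pairing a x = (finrank k (Kn n) : k)⁻¹ *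
        Algebra.trace k (Kn n) (⟨a * x.1 n, mul_mem ha (x.2.1 n)⟩ : Kn n))
    (q : ℕ → ℕ)
    (hq : ∀ n : ℕ, IsGreatest
      {r : ℝ | (∃ x : Kn n, Knorm ↑x ^ (finrank k (Kn n) : ℝ) = r) ∧ r < 1} ((q n : ℝ)⁻¹))
    (χ : k → ℂ)
    (hχadd : ∀ x y : k, χ (x + y) = χ x * χ y)
    (hχnorm : ∀ x : k, ‖χ x‖ = 1)
    (hχcont : @Continuous _ _ (kTop p k) _ χ)
    (hχtriv : ∀ x : k, absk p k x ≤ 1 → χ x = 1)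
    (hχrank : ∃ x : k, absk p k x ≤ (q 1 : ℝ) ∧ χ x ≠ 1)
    (d : ℕ → ℕ)
    (hd : ∀ (n : ℕ) (x : Kn n),
      Knorm ↑x ^ (finrank k (Kn n) : ℝ) ≤ (q n : ℝ) ^ (d n : ℝ) ↔
        ∀ y : Kn n, Knorm ↑y ≤ 1 → absk p k (Algebra.trace k (Kn n) (x * y)) ≤ 1)
    (μ : @MeasureTheory.Measure (ProjLim k K Kn T) (projMeas k K Kn T Knorm))
    (hμprob : MeasureTheory.IsProbabilityMeasure μ)
    (hμradon : ∀ A : Set (ProjLim k K Kn T), MeasurableSet[projMeas k K Kn T Knorm] A →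
      μ A = ⨆ (C : Set (ProjLim k K Kn T))
        (_ : C ⊆ A ∧ @IsCompact _ (projTop k K Kn T Knorm) C), μ C)
    (hμchar : ∀ a : K, ∫ x, χ (pairing a x) ∂μ = if Knorm a ≤ 1 then (1 : ℂ) else 0)
    :
    μ {x : ProjLim k K Kn T | ∀ n : ℕ, 1 ≤ n → Knorm (x.1 n) ≤ (q n : ℝ) ^ ((d n : ℝ) / (finrank k (Kn n) : ℝ)) * absk p k (finrank k (Kn n) : k)} = 1 := by
  have hmpos : ∀ n, 0 < finrank k (Kn n) := fun n => finrank_pos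
  have hKmul : ∀ n (x y : K), x ∈ Kn n → y ∈ Kn n → Knorm (x * y) = Knorm x * Knorm y := by
    intro n x y hx hy
    rw [hKnorm n x hx, hKnorm n y hy, hKnorm n _ (mul_mem hx hy),
      ← Real.mul_rpow (absk_nonneg ..) (absk_nonneg ..), ← absk_mul, ← map_mul]
    rfl
  have hKalg : ∀ (c : k), Knorm (algebraMap k K c) = absk p k c := by
    intro c
    have hc : (⟨algebraMap k K c, (Kn 1).algebraMap_mem c⟩ : Kn 1) = algebraMap k (Kn 1) c := rfl
    rw [hKnorm 1 _ ((Kn 1).algebraMap_mem c), hc, Algebra.norm_algebraMap, absk_pow]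
    exact Real.pow_rpow_inv_natCast (absk_nonneg ..) (hmpos 1).ne'
  have hq1 : ∀ z : k, 1 < absk p k z → (q 1 : ℝ) ≤ absk p k z := by
    intro z hz
    have hfin : finrank k (Kn 1) = 1 := by rw [hbot]; exact IntermediateField.finrank_bot
    have hle : (absk p k z)⁻¹ ≤ (q 1 : ℝ)⁻¹ := by
      refine (hq 1).2 ⟨⟨algebraMap k (Kn 1) z⁻¹, ?_⟩, inv_lt_one_of_one_lt₀ hz⟩
      rw [hfin, Nat.cast_one, Real.rpow_one, ← absk_inv]
      exact hKalg z⁻¹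
    have hz0 : 0 < absk p k z := zero_lt_one.trans hz
    exact (inv_le_inv₀ hz0 (inv_pos.mp ((inv_pos.mpr hz0).trans_le hle))).mp hle
  obtain ⟨w, hw, hχw⟩ := hχrank
  have key : ∀ n, ∀ᵐ x ∂μ, Knorm (x.1 n) ≤
      (q n : ℝ) ^ ((d n : ℝ) / (finrank k (Kn n) : ℝ)) * absk p k (finrank k (Kn n) : k) := by
    intro n
    obtain ⟨D, hDS, hDc, hD⟩ := exists_countable_approx p k {b : Kn n | Knorm b ≤ 1}
    have hae : ∀ᵐ x ∂μ, ∀ c ∈ D, χ (pairing c x) = 1 := by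
      rw [ae_ball_iff hDc]
      intro c hc
      refine ae_eq_one_of_integral_eq_one (fun x => hχnorm _) ?_
      exact (hμchar c).trans (if_pos (hDS hc))
    filter_upwards [hae] with x hx
    set m := finrank k (Kn n)
    have hCharK : CharZero k := charZero_of_injective_algebraMap (algebraMap ℚ_[p] k).injective
    have hm0 : (m : k) ≠ 0 := Nat.cast_ne_zero.mpr (hmpos n).ne'
    let X : Kn n := ⟨x.1 n, x.2.1 n⟩
    let Y : Kn n := (m : k)⁻¹ • X
    let f : Kn n →ₗ[k] k := Algebra.trace k (Kn n) ∘ₗ LinearMap.mulLeft k Y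
    have hfp : ∀ b : Kn n, pairing b x = f b := by
      intro b
      rw [hpair n b b.2 x]
      simp only [f, Y, LinearMap.comp_apply, LinearMap.mulLeft_apply, smul_mul_assoc,
        _root_.map_smul, smul_eq_mul]
      rw [mul_comm X b]
      rfl
    have hχf : ∀ b : Kn n, Knorm b ≤ 1 → χ (f b) = 1 := by
      intro b hb
      obtain ⟨c, hc, hbc⟩ := hD f b hb
      rw [← sub_add_cancel b c, map_add, hχadd, hχtriv _ hbc, ← hfp, hx c hc, one_mul]
    have hY : ∀ b : Kn n, Knorm b ≤ 1 → absk p k (Algebra.trace k (Kn n) (Y * b)) ≤ 1 := by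
      intro b hb
      by_contra! hlt
      have hz0 : 0 < absk p k (f b) := zero_lt_one.trans hlt
      have hfb : f b ≠ 0 := by
        intro h
        rw [h, absk_zero] at hz0
        exact hz0.false
      apply hχw
      have hc : absk p k (w * (f b)⁻¹) ≤ 1 := by
        rw [absk_mul, absk_inv, ← div_eq_mul_inv, div_le_one hz0]
        exact hw.trans (hq1 _ hlt)
      have hcb : Knorm ((w * (f b)⁻¹) • b : Kn n) ≤ 1 := by
        have : (((w * (f b)⁻¹) • b : Kn n) : K) = algebraMap k K (w * (f b)⁻¹) * b := by
          simp [Algebra.smul_def]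
        rw [this, hKmul n _ _ ((Kn n).algebraMap_mem _) b.2, hKalg]
        have hb0 : 0 ≤ Knorm b := by
          rw [hKnorm n b b.2]
          exact Real.rpow_nonneg (absk_nonneg ..) _
        exact mul_le_one₀ hc hb0 hb
      have := hχf _ hcb
      rwa [_root_.map_smul, smul_eq_mul, inv_mul_cancel_right₀ hfb] at this
    have hYn := (hd n Y).mpr hY
    have hY0 : 0 ≤ Knorm Y := by
      rw [hKnorm n Y Y.2]
      exact Real.rpow_nonneg (absk_nonneg ..) _
    have hmR : (0 : ℝ) < m := Nat.cast_pos.mpr (hmpos n)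
    have hYle : Knorm Y ≤ (q n : ℝ) ^ ((d n : ℝ) / (m : ℝ)) := by
      rw [div_eq_mul_inv, Real.rpow_mul (Nat.cast_nonneg _)]
      exact (Real.le_rpow_inv_iff_of_pos hY0 (Real.rpow_nonneg (Nat.cast_nonneg _) _) hmR).mpr hYn
    have hXY : x.1 n = Y * algebraMap k K m := by
      have h : X = Y * algebraMap k (Kn n) m := by
        rw [mul_comm, ← Algebra.smul_def, smul_inv_smul₀ hm0]
      exact congrArg Subtype.val h
    rw [hXY, hKmul n _ _ Y.2 ((Kn n).algebraMap_mem _), hKalg]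
    exact mul_le_mul_of_nonneg_right hYle (absk_nonneg ..)
  have hall : ∀ᵐ x ∂μ, ∀ n : ℕ, 1 ≤ n → Knorm (x.1 n) ≤
      (q n : ℝ) ^ ((d n : ℝ) / (finrank k (Kn n) : ℝ)) * absk p k (finrank k (Kn n) : k) := by
    rw [ae_all_iff]
    exact fun n => (key n).mono fun x hx _ => hx
  rw [measure_congr (Filter.eventuallyEq_univ.mpr hall)]
  exact hμprob.measure_univ
end

section
/- Fix n ≥ 1. A function F : K → ℂ is equal to the Fourier transform f̂ of some function f ∈ D(K̄) of the form f(x) = φ(T_n(x)), φ ∈ D(K_n), if and only if the following three conditions hold: (i) the restriction of F to K_ν belongs to D(K_ν) for every ν ≥ n; (ii) F(ξ + ξ') = F(ξ) for all ξ, ξ' ∈ K with ‖ξ'‖ ≤ 1; (iii) F(ξ) = 0 whenever dist(ξ, K_n) > 1, where dist(ξ, K_n) = inf_{η ∈ K_n} ‖ξ − η‖. -/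
open MeasureTheory Module
open scoped Classical

theorem spectralNorm_algHom {F L M : Type*} [NormedField F] [Field L] [Algebra F L] [Field M]
    [Algebra F M] (σ : L →ₐ[F] M) (x : L) : spectralNorm F M (σ x) = spectralNorm F L x := by
  simp only [spectralNorm, minpoly.algHom_eq σ σ.injective x]

theorem norm_algebraNorm_eq_spectralNorm_pow (p : ℕ) [Fact p.Prime] {L : Type*} [Field L]
    [Algebra ℚ_[p] L] [FiniteDimensional ℚ_[p] L] (x : L) :
    ‖Algebra.norm ℚ_[p] x‖ = spectralNorm ℚ_[p] L x ^ finrank ℚ_[p] L := by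
  have h := Algebra.norm_eq_prod_embeddings ℚ_[p] (AlgebraicClosure ℚ_[p]) x
  have h2 := congrArg (spectralMulAlgNorm ℚ_[p] (AlgebraicClosure ℚ_[p])) h
  rw [map_prod] at h2
  simp only [spectralMulAlgNorm_def, spectralNorm_extends, spectralNorm_algHom] at h2
  rw [h2, Finset.prod_const, Finset.card_univ, AlgHom.card]

theorem spectralNorm_algebraTrace_le (p : ℕ) [Fact p.Prime] {F L : Type*} [Field F] [Field L]
    [Algebra ℚ_[p] F] [Algebra ℚ_[p] L] [Algebra F L] [IsScalarTower ℚ_[p] F L]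
    [FiniteDimensional ℚ_[p] L] [FiniteDimensional ℚ_[p] F] (x : L) :
    spectralNorm ℚ_[p] F (Algebra.trace F L x) ≤ spectralNorm ℚ_[p] L x := by
  have : FiniteDimensional F L := FiniteDimensional.right ℚ_[p] F L
  have : CharZero F := charZero_of_injective_algebraMap (algebraMap ℚ_[p] F).injective
  have : Algebra.IsAlgebraic ℚ_[p] (AlgebraicClosure F) := Algebra.IsAlgebraic.trans ℚ_[p] F _
  have h : algebraMap F (AlgebraicClosure F) (Algebra.trace F L x) = _ :=
    trace_eq_sum_embeddings (AlgebraicClosure F)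
  rw [spectralNorm.eq_of_tower (L := AlgebraicClosure F), h]
  have : Nonempty (L →ₐ[F] AlgebraicClosure F) := ⟨IsAlgClosed.lift⟩
  obtain ⟨σ, -, hσ⟩ := IsNonarchimedean.finset_image_add
    (spectralNorm_zero (K := ℚ_[p]) (L := AlgebraicClosure F)) spectralNorm_nonneg
    isNonarchimedean_spectralNorm (fun σ : L →ₐ[F] AlgebraicClosure F => σ x) Finset.univ
  exact hσ.trans_eq (spectralNorm_algHom (σ.restrictScalars ℚ_[p]) x)

theorem exists_finset_spectralNorm_sub_lt (p : ℕ) [Fact p.Prime] (L : Type*) [Field L]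
    [Algebra ℚ_[p] L] [FiniteDimensional ℚ_[p] L] (ρ : ℝ) {ε : ℝ} (hε : 0 < ε) :
    ∃ t : Finset L, ∀ a, spectralNorm ℚ_[p] L a ≤ ρ →
      ∃ b ∈ t, spectralNorm ℚ_[p] L (a - b) < ε := by
  let := spectralNorm.normedField ℚ_[p] L
  let : NormedSpace ℚ_[p] L := spectralNorm.normedSpace ℚ_[p] L
  have : ProperSpace L := FiniteDimensional.proper ℚ_[p] L
  obtain ⟨t, -, ht, h⟩ := Metric.finite_approx_of_totallyBounded
    (isCompact_closedBall (0 : L) ρ).totallyBounded ε hε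
  refine ⟨ht.toFinset, fun a ha => ?_⟩
  have := h (show a ∈ Metric.closedBall 0 ρ from mem_closedBall_zero_iff.2 ha)
  rw [Set.mem_iUnion₂] at this
  obtain ⟨b, hb, hab⟩ := this
  exact ⟨b, ht.mem_toFinset.2 hb, hab⟩

theorem exists_uniform_of_spectralNorm (p : ℕ) [Fact p.Prime] {L : Type*} [Field L]
    [Algebra ℚ_[p] L] [FiniteDimensional ℚ_[p] L] {φ : L → ℂ}
    (hφ : ∀ x, ∃ ε > 0, ∀ y, spectralNorm ℚ_[p] L (y - x) < ε → φ y = φ x)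
    {ρ : ℝ} (hρ : ∀ x, ρ < spectralNorm ℚ_[p] L x → φ x = 0) :
    (∃ δ > 0, ∀ x y, spectralNorm ℚ_[p] L (y - x) < δ → φ y = φ x) ∧ ∃ C, ∀ x, ‖φ x‖ ≤ C := by
  let := spectralNorm.normedField ℚ_[p] L
  let : NormedSpace ℚ_[p] L := spectralNorm.normedSpace ℚ_[p] L
  have : ProperSpace L := FiniteDimensional.proper ℚ_[p] L
  have hlc : IsLocallyConstant φ := by
    refine IsLocallyConstant.iff_eventually_eq φ |>.2 fun x => ?_
    obtain ⟨ε, hε, h⟩ := hφ x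
    filter_upwards [Metric.ball_mem_nhds x hε] with y hy using h y hy
  have hc := isCompact_closedBall (0 : L) ρ
  have h0 : ∀ x ∉ Metric.closedBall (0 : L) ρ, φ x = 0 := fun x hx =>
    hρ x (not_le.1 fun h => hx (mem_closedBall_zero_iff.2 h))
  constructor
  · obtain ⟨δ, hδ, h⟩ := lebesgue_number_lemma_of_metric hc
      (fun z => hlc.isOpen_fiber z) (fun x _ => Set.mem_iUnion.2 ⟨φ x, rfl⟩)
    have key : ∀ x y, x ∈ Metric.closedBall (0 : L) ρ → dist y x < δ → φ y = φ x := by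
      intro x y hx hy
      obtain ⟨z, hz⟩ := h x hx
      exact (hz hy : φ y = z).trans (hz (Metric.mem_ball_self hδ) : φ x = z).symm
    refine ⟨δ, hδ, fun x y hxy => ?_⟩
    change dist y x < δ at hxy
    by_cases hx : x ∈ Metric.closedBall (0 : L) ρ
    · exact key x y hx hxy
    by_cases hy : y ∈ Metric.closedBall (0 : L) ρ
    · exact (key y x hy (by rwa [dist_comm])).symm
    · rw [h0 x hx, h0 y hy]
  · obtain ⟨C, hC⟩ := hc.exists_bound_of_continuousOn hlc.continuous.continuousOn
    refine ⟨max C 0, fun x => ?_⟩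
    by_cases hx : x ∈ Metric.closedBall (0 : L) ρ
    · exact (hC x hx).trans (le_max_left _ _)
    · simp [h0 x hx]

/-- A family of unitary characters `e a` on a probability space, indexed by an ultrametric group `K`
and orthogonal modulo its unit ball, together with a locally compact subgroup `V` of `K` for which
`e a` factors through a nondegenerate self-pairing of `V`. -/
structure CharacterSystem {K V X : Type} [AddCommGroup K] [AddCommGroup V] [MeasurableSpace X]
    (μ : Measure X) (N : K → ℝ) (e : K → X → ℂ) (ι : V →+ K) (π : X → V) (E : V → V → ℂ)
    (R : ℝ) : Prop where
  bound_pos : 0 < R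
  norm_zero : N 0 = 0
  norm_nonneg : ∀ a, 0 ≤ N a
  norm_neg : ∀ a, N (-a) = N a
  norm_add_le : ∀ a b, N (a + b) ≤ max (N a) (N b)
  char_add : ∀ a b x, e (a + b) x = e a x * e b x
  norm_char : ∀ a x, ‖e a x‖ = 1
  measurable_char : ∀ a, Measurable (e a)
  integral_char : ∀ a, ∫ x, e a x ∂μ = if N a ≤ 1 then 1 else 0
  char_apply : ∀ a x, e (ι a) x = E a (π x)
  pair_add_left : ∀ a b v, E (a + b) v = E a v * E b v
  pair_add_right : ∀ a u v, E a (u + v) = E a u * E a v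
  norm_pair : ∀ a v, ‖E a v‖ = 1
  nondegenerate : ∀ v ρ, 0 < ρ → (∀ a, N (ι a) ≤ ρ → E a v = 1) → ρ * N (ι v) ≤ R
  pair_eq_one_left : ∀ v, ∃ ε > 0, ∀ a, N (ι a) < ε → E a v = 1
  pair_eq_one_right : ∀ a, ∃ ε > 0, ∀ v, N (ι v) < ε → E a v = 1
  exists_cover : ∀ ρ, ∀ ε > 0, ∃ t : Finset V, ∀ a, N (ι a) ≤ ρ → ∃ b ∈ t, N (ι (a - b)) < ε

namespace CharacterSystem

variable {K V X : Type} [AddCommGroup K] [AddCommGroup V] [MeasurableSpace X]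
  {μ : Measure X} {N : K → ℝ} {e : K → X → ℂ} {ι : V →+ K} {π : X → V} {E : V → V → ℂ} {R : ℝ}

theorem norm_sub_le (h : CharacterSystem μ N e ι π E R) (a b : K) :
    N (a - b) ≤ max (N a) (N b) := by
  simpa [sub_eq_add_neg, h.norm_neg] using h.norm_add_le a (-b)

theorem norm_sub_comm (h : CharacterSystem μ N e ι π E R) (a b : K) : N (a - b) = N (b - a) := by
  rw [← h.norm_neg, neg_sub]

theorem pair_ne_zero (h : CharacterSystem μ N e ι π E R) (a v : V) : E a v ≠ 0 := by
  rw [← _root_.norm_ne_zero_iff, h.norm_pair]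
  exact one_ne_zero

theorem pair_zero_right (h : CharacterSystem μ N e ι π E R) (a : V) : E a 0 = 1 := by
  have := h.pair_add_right a 0 0
  rw [add_zero] at this
  exact (mul_eq_left₀ (h.pair_ne_zero a 0)).1 this.symm

theorem pair_zero_left (h : CharacterSystem μ N e ι π E R) (v : V) : E 0 v = 1 := by
  have := h.pair_add_left 0 0 v
  rw [add_zero] at this
  exact (mul_eq_left₀ (h.pair_ne_zero 0 v)).1 this.symm

theorem pair_neg_right (h : CharacterSystem μ N e ι π E R) (a v : V) : E a (-v) = (E a v)⁻¹ := by
  apply eq_inv_of_mul_eq_one_left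
  rw [← h.pair_add_right, neg_add_cancel, h.pair_zero_right]

theorem pair_neg_left (h : CharacterSystem μ N e ι π E R) (a v : V) : E (-a) v = (E a v)⁻¹ := by
  apply eq_inv_of_mul_eq_one_left
  rw [← h.pair_add_left, neg_add_cancel, h.pair_zero_left]

/-- A complete system of representatives of a ball of `V` modulo the unit ball. -/
theorem exists_representatives (h : CharacterSystem μ N e ι π E R) (ρ : ℝ) :
    ∃ (Q : Type) (_ : Fintype Q) (r : Q → V), (∀ q, N (ι (r q)) ≤ ρ) ∧
      (∀ a, N (ι a) ≤ ρ → ∃ q, N (ι (a - r q)) ≤ 1) ∧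
      ∀ q q', N (ι (r q - r q')) ≤ 1 → q = q' := by
  let s : Setoid {a : V // N (ι a) ≤ ρ} :=
    { r := fun a b => N (ι (a.1 - b.1)) ≤ 1
      iseqv :=
        { refl := fun a => by simp [h.norm_zero]
          symm := fun {a b} hab => by rwa [map_sub, h.norm_sub_comm, ← map_sub]
          trans := fun {a b c} hab hbc => by
            have := (h.norm_add_le (ι (a.1 - b.1)) (ι (b.1 - c.1))).trans (max_le hab hbc)
            rwa [← map_add, sub_add_sub_cancel] at this } }
  have hsep : ∀ q q' : Quotient s, N (ι (q.out.1 - q'.out.1)) ≤ 1 → q = q' := by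
    intro q q' hq
    rw [← q.out_eq, ← q'.out_eq]
    exact Quotient.sound hq
  have : Finite (Quotient s) := by
    obtain ⟨t, ht⟩ := h.exists_cover ρ 1 one_pos
    choose f hft hf using fun q : Quotient s => ht q.out.1 q.out.2
    refine Finite.of_injective (fun q => (⟨f q, hft q⟩ : t)) fun q q' hqq' => hsep q q' ?_
    have hff : f q = f q' := congrArg Subtype.val hqq'
    have := (h.norm_sub_le (ι (q.out.1 - f q)) (ι (q'.out.1 - f q'))).trans
      (max_le (hf q).le (hf q').le)
    rwa [← map_sub, hff, sub_sub_sub_cancel_right] at this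
  refine ⟨Quotient s, Fintype.ofFinite _, fun q => q.out.1, fun q => q.out.2, fun a ha => ?_, hsep⟩
  exact ⟨Quotient.mk s ⟨a, ha⟩, Setoid.symm' s (Quotient.mk_out (s := s) ⟨a, ha⟩)⟩

theorem integrable_char_mul (h : CharacterSystem μ N e ι π E R) (a : K) {g : X → ℂ}
    (hg : Integrable g μ) : Integrable (fun x => e a x * g x) μ :=
  hg.bdd_mul (h.measurable_char a).aestronglyMeasurable
    (Filter.Eventually.of_forall fun x => (h.norm_char a x).le)

theorem char_ae_eq_one [IsProbabilityMeasure μ] (h : CharacterSystem μ N e ι π E R) {a : K}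
    (ha : N a ≤ 1) : ∀ᵐ x ∂μ, e a x = 1 := by
  have hφint : Integrable (e a) μ :=
    Integrable.of_bound (h.measurable_char a).aestronglyMeasurable 1
      (Filter.Eventually.of_forall fun x => (h.norm_char a x).le)
  have hre_int : Integrable (fun x => (e a x).re) μ := hφint.re
  have hre : ∀ x, 0 ≤ 1 - (e a x).re := fun x => by
    have := Complex.re_le_norm (e a x)
    rw [h.norm_char] at this
    linarith
  have hzero : ∫ x, (1 - (e a x).re) ∂μ = 0 := by
    rw [integral_sub (integrable_const _) hre_int]
    have : ∫ x, (e a x).re ∂μ = (∫ x, e a x ∂μ).re := integral_re hφint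
    rw [this, h.integral_char, if_pos ha]
    simp
  have := (integral_eq_zero_iff_of_nonneg hre ((integrable_const _).sub hre_int)).1 hzero
  filter_upwards [this] with x hx
  have hx1 : (e a x).re = 1 := by
    have : 1 - (e a x).re = 0 := hx
    linarith
  have hn := h.norm_char a x
  have hsq := Complex.sq_norm (e a x)
  rw [hn, Complex.normSq_apply, hx1] at hsq
  have him : (e a x).im = 0 := by nlinarith
  exact Complex.ext hx1 him

theorem ae_pair_eq_one [IsProbabilityMeasure μ] (h : CharacterSystem μ N e ι π E R) :
    ∀ᵐ x ∂μ, ∀ a, N (ι a) ≤ 1 → E a (π x) = 1 := by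
  choose t ht using fun j : ℕ => h.exists_cover 1 (1 / ((j : ℝ) + 1)) (by positivity)
  have hae : ∀ᵐ x ∂μ, ∀ j : ℕ, ∀ b ∈ t j, N (ι b) ≤ 1 → E b (π x) = 1 := by
    rw [ae_all_iff]
    intro j
    refine (ae_ball_iff (t j).countable_toSet).2 fun b _ => ?_
    by_cases hb : N (ι b) ≤ 1
    · filter_upwards [h.char_ae_eq_one hb] with x hx _
      rw [← h.char_apply, hx]
    · exact Filter.Eventually.of_forall fun x hx => absurd hx hb
  filter_upwards [hae] with x hx a ha
  obtain ⟨ε, hε, hloc⟩ := h.pair_eq_one_left (π x)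
  obtain ⟨j, hj⟩ := exists_nat_one_div_lt hε
  obtain ⟨b, hb, hab⟩ := ht j a ha
  have hle : (1 : ℝ) / ((j : ℝ) + 1) ≤ 1 := by
    rw [div_le_one (by positivity)]
    linarith [Nat.cast_nonneg (α := ℝ) j]
  have hb1 : N (ι b) ≤ 1 := by
    have := (h.norm_sub_le (ι a) (ι (a - b))).trans (max_le ha (hab.le.trans hle))
    rwa [← map_sub, sub_sub_cancel] at this
  have := h.pair_add_left (a - b) b (π x)
  rwa [sub_add_cancel, hx j b hb hb1, hloc _ (hab.trans hj), one_mul] at this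

theorem ae_norm_le [IsProbabilityMeasure μ] (h : CharacterSystem μ N e ι π E R) :
    ∀ᵐ x ∂μ, N (ι (π x)) ≤ R := by
  filter_upwards [h.ae_pair_eq_one] with x hx
  simpa using h.nondegenerate (π x) 1 one_pos hx

/-- Orthogonality: a vector on which the sum of the characters over a ball does not vanish is
annihilated by the whole ball. -/
theorem pair_eq_one_of_sum_ne_zero (h : CharacterSystem μ N e ι π E R) {ρ : ℝ} {Q : Type}
    [Fintype Q] {r : Q → V} (hr : ∀ q, N (ι (r q)) ≤ ρ)
    (hcov : ∀ a, N (ι a) ≤ ρ → ∃ q, N (ι (a - r q)) ≤ 1)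
    (hsep : ∀ q q', N (ι (r q - r q')) ≤ 1 → q = q')
    {v : V} (hv : ∀ a, N (ι a) ≤ 1 → E a v = 1) (hsum : ∑ q, E (r q) v ≠ 0)
    {b : V} (hb : N (ι b) ≤ ρ) : E b v = 1 := by
  have hrb : ∀ q, N (ι (r q + b)) ≤ ρ := fun q => by
    rw [map_add]
    exact (h.norm_add_le _ _).trans (max_le (hr q) hb)
  choose σ hσ using fun q => hcov (r q + b) (hrb q)
  have hinj : Function.Injective σ := fun q q' hqq' => hsep q q' (by
    have := (h.norm_sub_le _ _).trans (max_le (hσ q) (hσ q'))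
    rwa [← map_sub, hqq', sub_sub_sub_cancel_right, add_sub_add_right_eq_sub] at this)
  have hval : ∀ q, E (r (σ q)) v = E (r q) v * E b v := fun q => by
    rw [← h.pair_add_left, ← sub_add_cancel (r q + b) (r (σ q)), h.pair_add_left _ (r (σ q)),
      hv _ (hσ q), one_mul]
  have hperm : ∑ q, E (r (σ q)) v = ∑ q, E (r q) v :=
    (Equiv.ofBijective σ (Finite.injective_iff_bijective.1 hinj)).sum_comp fun q => E (r q) v
  simp only [hval, ← Finset.sum_mul] at hperm
  exact (mul_eq_left₀ hsum).1 hperm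

/-- The Fourier transform of a cylindrical test function is a finite combination of indicators of
unit balls centred in `V`. -/
theorem exists_integral_eq_sum [IsProbabilityMeasure μ] (h : CharacterSystem μ N e ι π E R)
    {φ : V → ℂ} (hφint : Integrable (fun x => φ (π x)) μ)
    {δ : ℝ} (hδ : 0 < δ) (hφ : ∀ u v, N (ι (v - u)) < δ → φ v = φ u) :
    ∃ (Q : Type) (_ : Fintype Q) (r : Q → V) (c : Q → ℂ), ∀ ξ,
      ∫ x, e ξ x * φ (π x) ∂μ = ∑ q, c q * if N (ξ + ι (r q)) ≤ 1 then 1 else 0 := by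
  set ρ : ℝ := max 1 ((R + 1) / δ)
  have hρ1 : 1 ≤ ρ := le_max_left _ _
  have hρ0 : 0 < ρ := one_pos.trans_le hρ1
  have hρR : R + 1 ≤ ρ * δ := (div_le_iff₀ hδ).1 (le_max_right _ _)
  obtain ⟨Q, _, r, hr, hcov, hsep⟩ := h.exists_representatives ρ
  obtain ⟨q₀, hq₀⟩ := hcov 0 (by simpa [h.norm_zero] using hρ0.le)
  rw [zero_sub, map_neg, h.norm_neg] at hq₀
  have hunit : ∀ q, N (ι (r q)) ≤ 1 ↔ q = q₀ := fun q =>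
    ⟨fun hq => hsep q q₀ (by
      rw [map_sub]
      exact (h.norm_sub_le _ _).trans (max_le hq hq₀)), fun hq => hq ▸ hq₀⟩
  set c : Q → ℂ := fun q => ∫ y, e (-ι (r q)) y * φ (π y) ∂μ
  have hone : Integrable (fun _ : X => (1 : ℂ)) μ := integrable_const _
  have hinv : ∀ᵐ x ∂μ, φ (π x) = ∑ q, c q * e (ι (r q)) x := by
    filter_upwards [h.ae_pair_eq_one] with x hx
    have hkey : ∀ᵐ y ∂μ, ∑ q, e (ι (r q)) x * (e (-ι (r q)) y * φ (π y)) =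
        ∑ q, e (ι (r q)) x * φ (π x) * (e (-ι (r q)) y * 1) := by
      filter_upwards [h.ae_pair_eq_one] with y hy
      have hE : ∀ q, e (ι (r q)) x * e (-ι (r q)) y = E (r q) (π x - π y) := fun q => by
        rw [← map_neg, h.char_apply, h.char_apply, h.pair_neg_left, sub_eq_add_neg,
          h.pair_add_right, h.pair_neg_right]
      have h1 : ∑ q, e (ι (r q)) x * (e (-ι (r q)) y * φ (π y)) =
          (∑ q, E (r q) (π x - π y)) * φ (π y) := by
        rw [Finset.sum_mul]
        exact Finset.sum_congr rfl fun q _ => by rw [← hE, mul_assoc]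
      have h2 : ∑ q, e (ι (r q)) x * φ (π x) * (e (-ι (r q)) y * 1) =
          (∑ q, E (r q) (π x - π y)) * φ (π x) := by
        rw [Finset.sum_mul]
        exact Finset.sum_congr rfl fun q _ => by rw [← hE]; ring
      rw [h1, h2]
      by_cases hs : ∑ q, E (r q) (π x - π y) = 0
      · rw [hs, zero_mul, zero_mul]
      · have hv : ∀ a, N (ι a) ≤ 1 → E a (π x - π y) = 1 := fun a ha => by
          rw [sub_eq_add_neg, h.pair_add_right, h.pair_neg_right, hx a ha, hy a ha, inv_one,
            one_mul]
        have hle := h.nondegenerate _ ρ hρ0 fun b hb =>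
          h.pair_eq_one_of_sum_ne_zero hr hcov hsep hv hs hb
        rw [hφ (π y) (π x) (lt_of_mul_lt_mul_left (by linarith) hρ0.le)]
    have hI := integral_congr_ae hkey
    rw [integral_finsetSum _ fun q _ =>
        (h.integrable_char_mul (-ι (r q)) hφint).const_mul _,
      integral_finsetSum _ fun q _ =>
        (h.integrable_char_mul (-ι (r q)) hone).const_mul _] at hI
    simp only [integral_const_mul, mul_one, h.integral_char, h.norm_neg, hunit] at hI
    simp only [mul_ite, mul_one, mul_zero, Finset.sum_ite_eq', Finset.mem_univ, if_true] at hI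
    rw [h.char_apply _ x, hx _ hq₀, one_mul] at hI
    rw [← hI]
    exact Finset.sum_congr rfl fun q _ => mul_comm _ _
  refine ⟨Q, inferInstance, r, c, fun ξ => ?_⟩
  have hcongr : ∀ᵐ x ∂μ, e ξ x * φ (π x) = ∑ q, c q * (e (ξ + ι (r q)) x * 1) := by
    filter_upwards [hinv] with x hx
    rw [hx, Finset.mul_sum]
    exact Finset.sum_congr rfl fun q _ => by rw [h.char_add]; ring
  rw [integral_congr_ae hcongr, integral_finsetSum _ fun q _ =>
    (h.integrable_char_mul (ξ + ι (r q)) hone).const_mul _]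
  simp only [integral_const_mul, mul_one, h.integral_char]

/-- A function invariant under the unit ball, vanishing off the unit neighbourhood of `V`, and of
bounded support on `V` is the Fourier transform of a cylindrical test function. -/
theorem exists_eq_integral [IsProbabilityMeasure μ] (h : CharacterSystem μ N e ι π E R)
    {F : K → ℂ} (hF : ∀ ξ ξ', N ξ' ≤ 1 → F (ξ + ξ') = F ξ)
    {ρ : ℝ} (hρ : ∀ a, ρ < N (ι a) → F (ι a) = 0)
    (hV : ∀ ξ, (∀ a, 1 < N (ξ - ι a)) → F ξ = 0) :
    ∃ φ : V → ℂ, (∀ u, ∃ ε > 0, ∀ v, N (ι (v - u)) < ε → φ v = φ u) ∧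
      (∀ v, R < N (ι v) → φ v = 0) ∧ ∀ ξ, F ξ = ∫ x, e ξ x * φ (π x) ∂μ := by
  obtain ⟨Q, _, r, hr, hcov, hsep⟩ := h.exists_representatives ρ
  have hsum : ∀ ξ, F ξ = ∑ q, F (ι (r q)) * if N (ξ - ι (r q)) ≤ 1 then 1 else 0 := by
    intro ξ
    by_cases hq : ∃ q, N (ξ - ι (r q)) ≤ 1
    · obtain ⟨q, hq⟩ := hq
      rw [Finset.sum_eq_single q, if_pos hq, mul_one]
      · rw [← hF (ι (r q)) _ hq, add_sub_cancel]
      · intro q' _ hne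
        rw [if_neg, mul_zero]
        refine fun hq' => hne (hsep _ _ ?_)
        have := (h.norm_sub_le _ _).trans (max_le hq hq')
        rwa [sub_sub_sub_cancel_left, ← map_sub] at this
      · simp
    · rw [Finset.sum_eq_zero fun q _ => by rw [if_neg fun hle => hq ⟨q, hle⟩, mul_zero]]
      by_contra hne
      have : ∃ a, N (ξ - ι a) ≤ 1 := by
        by_contra! hcon
        exact hne (hV ξ hcon)
      obtain ⟨a, ha⟩ := this
      have hFa : F ξ = F (ι a) := by rw [← hF (ι a) _ ha, add_sub_cancel]
      have hale : N (ι a) ≤ ρ := by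
        by_contra! hcon
        exact hne (hFa.trans (hρ a hcon))
      obtain ⟨q, hq'⟩ := hcov a hale
      refine hq ⟨q, ?_⟩
      have := (h.norm_add_le _ _).trans (max_le ha hq')
      rwa [map_sub, sub_add_sub_cancel] at this
  refine ⟨fun v => if N (ι v) ≤ R then ∑ q, F (ι (r q)) * E (-r q) v else 0, fun u => ?_,
    fun v hv => if_neg hv.not_ge, fun ξ => ?_⟩
  · have hpos : ∃ ε > 0, ∀ v, N (ι (v - u)) < ε → (N (ι v) ≤ R ↔ N (ι u) ≤ R) := by
      by_cases hu : N (ι u) ≤ 0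
      · have hu0 : N (ι u) = 0 := le_antisymm hu (h.norm_nonneg _)
        refine ⟨R, h.bound_pos, fun v hv => ?_⟩
        have := h.norm_add_le (ι (v - u)) (ι u)
        rw [← map_add, sub_add_cancel, hu0, max_eq_left (h.norm_nonneg _)] at this
        exact iff_of_true (this.trans hv.le) (hu0 ▸ h.bound_pos.le)
      · refine ⟨N (ι u), not_le.1 hu, fun v hv => ?_⟩
        have h1 := h.norm_add_le (ι (v - u)) (ι u)
        rw [← map_add, sub_add_cancel, max_eq_right hv.le] at h1
        have h2 := h.norm_sub_le (ι v) (ι (v - u))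
        rw [← map_sub, sub_sub_cancel] at h2
        have h3 : N (ι u) ≤ N (ι v) := (le_max_iff.1 h2).resolve_right hv.not_ge
        rw [le_antisymm h1 h3]
    choose η hη hloc using fun q => h.pair_eq_one_right (-r q)
    obtain ⟨ε₀, hε₀, hball⟩ := hpos
    obtain ⟨ε, hε, hle⟩ : ∃ ε > 0, ∀ q, ε ≤ η q := by
      rcases isEmpty_or_nonempty Q with hQ | hQ
      · exact ⟨1, one_pos, fun q => (hQ.false q).elim⟩
      · obtain ⟨q, hq⟩ := Finite.exists_min η
        exact ⟨η q, hη q, hq⟩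
    refine ⟨min ε₀ ε, lt_min hε₀ hε, fun v hv => ?_⟩
    rw [lt_min_iff] at hv
    simp only [hball v hv.1]
    have : ∀ q, E (-r q) v = E (-r q) u := fun q => by
      rw [← sub_add_cancel v u, h.pair_add_right, hloc q _ (hv.2.trans_le (hle q)), one_mul]
    simp only [this]
  · have hcongr : ∀ᵐ x ∂μ, e ξ x * (if N (ι (π x)) ≤ R then
        ∑ q, F (ι (r q)) * E (-r q) (π x) else 0) =
        ∑ q, F (ι (r q)) * (e (ξ - ι (r q)) x * 1) := by
      filter_upwards [h.ae_norm_le] with x hx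
      rw [if_pos hx, Finset.mul_sum]
      refine Finset.sum_congr rfl fun q _ => ?_
      rw [← h.char_apply, sub_eq_add_neg, h.char_add, map_neg]
      ring
    rw [integral_congr_ae hcongr, integral_finsetSum _ fun q _ =>
      (h.integrable_char_mul _ (integrable_const (1 : ℂ))).const_mul _]
    simp only [integral_const_mul, mul_one, h.integral_char]
    exact hsum ξ

end CharacterSystem

/-- An open set of the topology of an ultrametric norm contains a ball around each of its points. -/
theorem exists_ball_subset_of_isOpen_normTopology {X : Type} [AddCommGroup X] {N : X → ℝ}
    (hN : ∀ a b, N (a + b) ≤ max (N a) (N b)) {U : Set X} (hU : @IsOpen _ (normTopology N) U) :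
    ∀ x ∈ U, ∃ ε > 0, ∀ y, N (y - x) < ε → y ∈ U := by
  have hU' : TopologicalSpace.GenerateOpen
    {U | ∃ x : X, ∃ ε : ℝ, 0 < ε ∧ U = {y : X | N (y - x) < ε}} U := hU
  clear hU
  induction hU' with
  | basic s hs =>
    obtain ⟨z, ε, hε, rfl⟩ := hs
    refine fun x hx => ⟨ε, hε, fun y hy => ?_⟩
    have := (hN (y - x) (x - z)).trans_lt (max_lt hy hx)
    rwa [sub_add_sub_cancel] at this
  | univ => exact fun x _ => ⟨1, one_pos, fun _ _ => trivial⟩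
  | inter s t hs ht ihs iht =>
    intro x hx
    obtain ⟨ε, hε, h1⟩ := ihs x hx.1
    obtain ⟨δ, hδ, h2⟩ := iht x hx.2
    exact ⟨min ε δ, lt_min hε hδ, fun y hy =>
      ⟨h1 y (hy.trans_le (min_le_left _ _)), h2 y (hy.trans_le (min_le_right _ _))⟩⟩
  | sUnion S hS ih =>
    rintro x ⟨s, hs, hx⟩
    obtain ⟨ε, hε, h1⟩ := ih s hs x hx
    exact ⟨ε, hε, fun y hy => ⟨s, hs, h1 y hy⟩⟩

theorem isTestFun_iff (k : Type) [Field k] (K : Type) [Field K] [Algebra k K]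
    (Kn : ℕ → IntermediateField k K) {N : K → ℝ} (hN0 : N 0 = 0)
    (hN : ∀ a b, N (a + b) ≤ max (N a) (N b)) (n : ℕ) (φ : Kn n → ℂ) :
    IsTestFun k K Kn N n φ ↔
      (∀ x : Kn n, ∃ ε > 0, ∀ y : Kn n, N ((y : K) - x) < ε → φ y = φ x) ∧
        ∃ R : ℝ, ∀ ξ : Kn n, R < N ξ → φ ξ = 0 := by
  let _ := normTopology N
  refine and_congr_left fun _ => ⟨fun h x => ?_, fun h s => ?_⟩
  · obtain ⟨U, hU, hUφ⟩ := isOpen_induced_iff.1 (h {φ x})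
    have hmem : ∀ y : Kn n, (y : K) ∈ U ↔ φ y = φ x := fun y => by
      rw [← Set.mem_preimage, hUφ]; rfl
    obtain ⟨ε, hε, hball⟩ := exists_ball_subset_of_isOpen_normTopology hN hU x ((hmem x).2 rfl)
    exact ⟨ε, hε, fun y hy => (hmem y).1 (hball y hy)⟩
  · let _ := KnTop k K Kn N n
    refine isOpen_iff_forall_mem_open.2 fun x hx => ?_
    obtain ⟨ε, hε, hball⟩ := h x
    refine ⟨{y | N ((y : K) - x) < ε}, fun y hy => ?_, ?_, ?_⟩
    · change _ ∈ s
      rw [hball y hy]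
      exact hx
    · exact isOpen_induced_iff.2 ⟨{y | N (y - x) < ε},
        TopologicalSpace.isOpen_generateFrom_of_mem ⟨x, ε, hε, rfl⟩, rfl⟩
    · simpa [hN0] using hε

/-- Cylindrical locally constant functions on the projective limit are Borel. -/
theorem measurable_of_locally_eq (k : Type) [Field k] (K : Type) [Field K] [Algebra k K]
    (Kn : ℕ → IntermediateField k K) (T : ℕ → K →ₗ[k] K) {N : K → ℝ} (hN0 : N 0 = 0)
    {g : ProjLim k K Kn T → ℂ} (n : ℕ)
    (hg : ∀ x, ∃ ε > 0, ∀ y : ProjLim k K Kn T, N (y.1 n - x.1 n) < ε → g y = g x) :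
    @Measurable _ _ (projMeas k K Kn T N) _ g := by
  let _ := projTop k K Kn T N
  let _ := projMeas k K Kn T N
  have : BorelSpace (ProjLim k K Kn T) := ⟨rfl⟩
  have hloc : IsLocallyConstant g := by
    intro s
    refine isOpen_iff_forall_mem_open.2 fun x hx => ?_
    obtain ⟨ε, hε, hball⟩ := hg x
    refine ⟨{y | N (y.1 n - x.1 n) < ε}, fun y hy => ?_, ?_, ?_⟩
    · change _ ∈ s
      rw [hball y hy]
      exact hx
    · exact TopologicalSpace.isOpen_generateFrom_of_mem ⟨x, n, ε, hε, rfl⟩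
    · simpa [hN0] using hε
  exact hloc.continuous.measurable

theorem prime_le_norm_of_one_lt_norm (p : ℕ) [Fact p.Prime] {x : ℚ_[p]} (hx : 1 < ‖x‖) :
    (p : ℝ) ≤ ‖x‖ := by
  have hp : 1 < (p : ℝ) := mod_cast (Fact.out : p.Prime).one_lt
  have hx0 : x ≠ 0 := by
    rintro rfl
    simp at hx
    linarith
  rw [Padic.norm_eq_zpow_neg_valuation hx0] at hx ⊢
  have := (one_lt_zpow_iff_right₀ hp).1 hx
  calc (p : ℝ) = (p : ℝ) ^ (1 : ℤ) := (zpow_one _).symm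
    _ ≤ _ := zpow_le_zpow_right₀ hp.le (by omega)

/-- The properties of a system of normalized absolute values and averaged trace forms on a tower
of finite extensions that are used in the Fourier analysis on its projective limit. -/
structure TowerNorm (p : ℕ) [Fact p.Prime] (k : Type) [Field k] [Algebra ℚ_[p] k] (K : Type)
    [Field K] [Algebra k K] (Kn : ℕ → IntermediateField k K) (N : K → ℝ) : Prop where
  zero : N 0 = 0
  pos : ∀ a, a ≠ 0 → 0 < N a
  neg : ∀ a, N (-a) = N a
  add_le : ∀ a b, N (a + b) ≤ max (N a) (N b)
  mul : ∀ a b, N (a * b) = N a * N b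
  trace_le : ∀ n, ∃ C > 0, ∀ a : Kn n,
    absk p k ((finrank k (Kn n) : k)⁻¹ * Algebra.trace k (Kn n) a) ≤ C * N a
  exists_cover : ∀ n ρ, ∀ ε > 0, ∃ t : Finset (Kn n), ∀ a : Kn n, N a ≤ ρ →
    ∃ b ∈ t, N ((a : K) - b) < ε
  uniform : ∀ (n : ℕ) (φ : Kn n → ℂ),
    (∀ x : Kn n, ∃ ε > 0, ∀ y : Kn n, N ((y : K) - x) < ε → φ y = φ x) → ∀ ρ : ℝ,
    (∀ x : Kn n, ρ < N x → φ x = 0) →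
    (∃ δ > 0, ∀ x y : Kn n, N ((y : K) - x) < δ → φ y = φ x) ∧ ∃ C, ∀ x, ‖φ x‖ ≤ C
  gap : ∀ n, ∃ c > 1, ∀ a : Kn n, 1 < N a → c ≤ N a

theorem towerNorm_of_eq (p : ℕ) [Fact p.Prime]
    (k : Type) [Field k] [Algebra ℚ_[p] k] [FiniteDimensional ℚ_[p] k]
    (K : Type) [Field K] [Algebra k K]
    (Kn : ℕ → IntermediateField k K)
    [hfd : ∀ n, FiniteDimensional k (Kn n)]
    (hunion : ∀ x : K, ∃ n, x ∈ Kn n)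
    (N : K → ℝ)
    (hN : ∀ (n : ℕ) (x : K) (hx : x ∈ Kn n),
      N x = absk p k (Algebra.norm k (⟨x, hx⟩ : Kn n)) ^ ((finrank k (Kn n) : ℝ)⁻¹)) :
    TowerNorm p k K Kn N := by
  let _ : Algebra ℚ_[p] K := ((algebraMap k K).comp (algebraMap ℚ_[p] k)).toAlgebra
  have : IsScalarTower ℚ_[p] k K := IsScalarTower.of_algebraMap_eq' rfl
  have hfdp : ∀ n, FiniteDimensional ℚ_[p] (Kn n) := fun n => FiniteDimensional.trans ℚ_[p] k (Kn n)
  have : CharZero k := charZero_of_injective_algebraMap (algebraMap ℚ_[p] k).injective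
  have halg : Algebra.IsAlgebraic k K := ⟨fun x => by
    obtain ⟨n, hx⟩ := hunion x
    exact (Algebra.IsAlgebraic.isAlgebraic (R := k) (⟨x, hx⟩ : Kn n)).algebraMap⟩
  have : Algebra.IsAlgebraic ℚ_[p] K := Algebra.IsAlgebraic.trans ℚ_[p] k K
  set d := finrank ℚ_[p] k
  have hd0 : d ≠ 0 := finrank_pos.ne'
  have hm0 : ∀ n, finrank k (Kn n) ≠ 0 := fun n => finrank_pos.ne'
  have hsub : ∀ n (x : Kn n), spectralNorm ℚ_[p] (Kn n) x = spectralNorm ℚ_[p] K (x : K) :=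
    fun n x =>
    have : IsScalarTower ℚ_[p] (Kn n) K := IsScalarTower.of_algebraMap_eq fun _ => rfl
    spectralNorm.eq_of_tower x
  have habsk : ∀ x : k, absk p k x = spectralNorm ℚ_[p] k x ^ d := fun x =>
    norm_algebraNorm_eq_spectralNorm_pow p x
  have hpow : ∀ x, N x = spectralNorm ℚ_[p] K x ^ d := by
    intro x
    obtain ⟨n, hx⟩ := hunion x
    rw [hN n x hx, absk, Algebra.norm_norm, norm_algebraNorm_eq_spectralNorm_pow, hsub,
      ← finrank_mul_finrank ℚ_[p] k (Kn n), pow_mul,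
      Real.pow_rpow_inv_natCast (pow_nonneg (spectralNorm_nonneg _) _) (hm0 n)]
  have hs0 : ∀ x, 0 ≤ spectralNorm ℚ_[p] K x := spectralNorm_nonneg
  have hlt : ∀ (x : K) (ε : ℝ), 0 < ε → (N x < ε ↔ spectralNorm ℚ_[p] K x < ε ^ (d : ℝ)⁻¹) := by
    intro x ε hε
    rw [hpow, Real.lt_rpow_inv_iff_of_pos (hs0 x) hε.le (by positivity), Real.rpow_natCast]
  have hrpow : ∀ ε : ℝ, 0 < ε → 0 < ε ^ (d : ℝ)⁻¹ := fun ε hε => Real.rpow_pos_of_pos hε _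
  have hle : ∀ (x : K) (ρ : ℝ), 0 ≤ ρ → (N x ≤ ρ ↔ spectralNorm ℚ_[p] K x ≤ ρ ^ (d : ℝ)⁻¹) := by
    intro x ρ hρ
    rw [hpow, Real.le_rpow_inv_iff_of_pos (hs0 x) hρ (by positivity), Real.rpow_natCast]
  refine
    { zero := by rw [hpow, spectralNorm_zero, zero_pow hd0]
      pos := fun a ha => by
        rw [hpow]
        exact pow_pos (spectralNorm_zero_lt ha (Algebra.IsAlgebraic.isAlgebraic a)) _
      neg := fun a => by
        rw [hpow, hpow, spectralNorm_neg (Algebra.IsAlgebraic.isAlgebraic a)]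
      add_le := fun a b => by
        simp only [hpow]
        rcases le_max_iff.1 (isNonarchimedean_spectralNorm (K := ℚ_[p]) a b) with h | h
        · exact le_max_of_le_left (pow_le_pow_left₀ (hs0 _) h _)
        · exact le_max_of_le_right (pow_le_pow_left₀ (hs0 _) h _)
      mul := fun a b => by
        simp only [hpow, ← mul_pow, ← spectralMulAlgNorm_def, map_mul]
      trace_le := fun n => ?_
      exists_cover := fun n ρ ε hε => ?_
      uniform := fun n φ hφ ρ hρ => ?_
      gap := fun n => ?_ }
  · have hmk : (finrank k (Kn n) : k)⁻¹ ≠ 0 := inv_ne_zero (Nat.cast_ne_zero.2 (hm0 n))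
    refine ⟨absk p k (finrank k (Kn n) : k)⁻¹, ?_, fun a => ?_⟩
    · rw [absk]
      exact norm_pos_iff.2 (Algebra.norm_ne_zero_iff.2 hmk)
    · rw [absk, map_mul, norm_mul]
      refine mul_le_mul_of_nonneg_left ?_ (norm_nonneg _)
      change absk p k _ ≤ _
      rw [habsk, hpow, ← hsub]
      exact pow_le_pow_left₀ (spectralNorm_nonneg _) (spectralNorm_algebraTrace_le p a) _
  · obtain ⟨t, ht⟩ := exists_finset_spectralNorm_sub_lt p (Kn n) ((max ρ 0) ^ (d : ℝ)⁻¹)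
      (hrpow ε hε)
    refine ⟨t, fun a ha => ?_⟩
    obtain ⟨b, hb, hab⟩ := ht a (by
      rw [hsub, ← hle _ _ (le_max_right _ _)]
      exact ha.trans (le_max_left _ _))
    exact ⟨b, hb, (hlt _ _ hε).2 (by rwa [hsub] at hab)⟩
  · obtain ⟨⟨δ, hδ, h⟩, hC⟩ := exists_uniform_of_spectralNorm p (φ := φ)
      (fun x => by
        obtain ⟨ε, hε, h⟩ := hφ x
        exact ⟨_, hrpow ε hε, fun y hy => h y ((hlt _ _ hε).2 (by rwa [hsub] at hy))⟩)
      (ρ := (max ρ 0) ^ (d : ℝ)⁻¹) (fun x hx => by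
        refine hρ x ((le_max_left ρ 0).trans_lt (not_le.1 fun hcon => ?_))
        rw [hle _ _ (le_max_right _ _), ← hsub] at hcon
        exact hcon.not_gt hx)
    refine ⟨⟨δ ^ d, pow_pos hδ _, fun x y hxy => h x y ?_⟩, hC⟩
    rw [hpow] at hxy
    rw [hsub]
    exact lt_of_pow_lt_pow_left₀ d hδ.le hxy
  · have hp : 1 < (p : ℝ) := mod_cast (Fact.out : p.Prime).one_lt
    have hm : 0 < ((finrank k (Kn n) : ℝ))⁻¹ :=
      inv_pos.2 (Nat.cast_pos.2 (Nat.pos_of_ne_zero (hm0 n)))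
    refine ⟨(p : ℝ) ^ (finrank k (Kn n) : ℝ)⁻¹, Real.one_lt_rpow hp hm, fun a ha => ?_⟩
    rw [hN n a a.2] at ha ⊢
    have h1 : 1 < absk p k (Algebra.norm k (⟨a, a.2⟩ : Kn n)) := by
      by_contra! hcon
      exact ha.not_ge (Real.rpow_le_one (norm_nonneg _) hcon hm.le)
    exact Real.rpow_le_rpow (by positivity) (prime_le_norm_of_one_lt_norm p h1) hm.le

/-- The characters of `K` on the projective limit form a character system with respect to each
layer of the tower. -/
theorem characterSystem_projLim
    (p : ℕ) [Fact (Nat.Prime p)]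
    (k : Type) [Field k] [Algebra ℚ_[p] k] [FiniteDimensional ℚ_[p] k]
    (K : Type) [Field K] [Algebra k K]
    (Kn : ℕ → IntermediateField k K)
    [hfd : ∀ n, FiniteDimensional k (Kn n)]
    (hunion : ∀ x : K, ∃ n, x ∈ Kn n)
    (hmono : Monotone Kn) (T : ℕ → K →ₗ[k] K)
    (Knorm : K → ℝ)
    (hT : TowerNorm p k K Kn Knorm)
    (pairing : K → ProjLim k K Kn T → k)
    (hpair : ∀ (n : ℕ) (a : K) (ha : a ∈ Kn n) (x : ProjLim k K Kn T),
      pairing a x = (finrank k (Kn n) : k)⁻¹ *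
        Algebra.trace k (Kn n) (⟨a * x.1 n, mul_mem ha (x.2.1 n)⟩ : Kn n))
    (χ : k → ℂ)
    (hχadd : ∀ x y : k, χ (x + y) = χ x * χ y)
    (hχnorm : ∀ x : k, ‖χ x‖ = 1)
    (hχtriv : ∀ x : k, absk p k x ≤ 1 → χ x = 1) {z : k} (hz : χ z ≠ 1)
    (μ : @MeasureTheory.Measure (ProjLim k K Kn T) (projMeas k K Kn T Knorm))
    (hμchar : ∀ a : K, ∫ x, χ (pairing a x) ∂μ = if Knorm a ≤ 1 then (1 : ℂ) else 0)
    (n : ℕ) :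
    @CharacterSystem K (Kn n) (ProjLim k K Kn T) _ _ (projMeas k K Kn T Knorm) μ Knorm
      (fun a x => χ (pairing a x)) (Kn n).val.toLinearMap.toAddMonoidHom
      (fun x => ⟨x.1 n, x.2.1 n⟩)
      (fun a v => χ ((finrank k (Kn n) : k)⁻¹ * Algebra.trace k (Kn n) (a * v)))
      (Knorm (algebraMap k K z)) := by
  let _ := projMeas k K Kn T Knorm
  have : CharZero k := charZero_of_injective_algebraMap (algebraMap ℚ_[p] k).injective
  have hχ0 : χ 0 = 1 := hχtriv 0 (by simp [absk])
  have hz0 : z ≠ 0 := by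
    rintro rfl
    exact hz hχ0
  have hzK : algebraMap k K z ≠ 0 := (map_ne_zero _).2 hz0
  have hnn : ∀ a, 0 ≤ Knorm a := fun a => by
    by_cases ha : a = 0
    · rw [ha, hT.zero]
    · exact (hT.pos a ha).le
  have hsmall : ∀ ν (a : Kn ν), ∃ ε > 0, ∀ w : Kn ν, Knorm (w : K) < ε →
      χ ((finrank k (Kn ν) : k)⁻¹ * Algebra.trace k (Kn ν) (a * w)) = 1 := by
    intro ν a
    obtain ⟨C, hC, h⟩ := hT.trace_le ν
    have hpos : 0 < C * (Knorm a + 1) := mul_pos hC (by linarith [hnn (a : K)])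
    refine ⟨(C * (Knorm a + 1))⁻¹, inv_pos.2 hpos, fun w hw => hχtriv _ ((h _).trans ?_)⟩
    have h1 : C * (Knorm a + 1) * Knorm w < 1 := by
      rw [mul_comm]
      exact (lt_div_iff₀ hpos).1 (by rwa [one_div])
    have h2 : ((a * w : Kn ν) : K) = (a : K) * w := rfl
    rw [h2, hT.mul]
    nlinarith [mul_nonneg hC.le (hnn (w : K))]
  have hpair_add : ∀ a b x, pairing (a + b) x = pairing a x + pairing b x := by
    intro a b x
    obtain ⟨i, hi⟩ := hunion a
    obtain ⟨j, hj⟩ := hunion b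
    have ha := hmono (le_max_left i j) hi
    have hb := hmono (le_max_right i j) hj
    rw [hpair _ a ha, hpair _ b hb, hpair _ (a + b) (add_mem ha hb), ← mul_add, ← map_add]
    congr 2
    exact Subtype.ext (add_mul _ _ _)
  exact
    { bound_pos := hT.pos _ hzK
      norm_zero := hT.zero
      norm_nonneg := hnn
      norm_neg := hT.neg
      norm_add_le := hT.add_le
      char_add := fun a b x => by rw [hpair_add, hχadd]
      norm_char := fun a x => hχnorm _
      measurable_char := fun a => by
        obtain ⟨ν, ha⟩ := hunion a
        refine measurable_of_locally_eq k K Kn T hT.zero ν fun x => ?_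
        obtain ⟨ε, hε, h⟩ := hsmall ν ⟨a, ha⟩
        refine ⟨ε, hε, fun y hy => ?_⟩
        have h1 := h ⟨y.1 ν - x.1 ν, sub_mem (y.2.1 ν) (x.2.1 ν)⟩ hy
        have h2 : pairing a y = (finrank k (Kn ν) : k)⁻¹ * Algebra.trace k (Kn ν)
            (⟨a, ha⟩ * ⟨y.1 ν - x.1 ν, sub_mem (y.2.1 ν) (x.2.1 ν)⟩) + pairing a x := by
          rw [hpair ν a ha, hpair ν a ha, ← mul_add, ← map_add]
          congr 2
          refine Subtype.ext ?_
          change a * y.1 ν = a * (y.1 ν - x.1 ν) + a * x.1 ν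
          ring
        rw [h2, hχadd, h1, one_mul]
      integral_char := hμchar
      char_apply := fun a x => congrArg χ (hpair n a a.2 x)
      pair_add_left := fun a b v => by rw [add_mul, map_add, mul_add, hχadd]
      pair_add_right := fun a u v => by rw [mul_add, map_add, mul_add, hχadd]
      norm_pair := fun a v => hχnorm _
      nondegenerate := fun v ρ hρ h => by
        by_cases hv : v = 0
        · subst hv
          change ρ * Knorm (0 : K) ≤ _
          rw [hT.zero, mul_zero]
          exact hnn _
        · by_contra! hcon
          change _ < ρ * Knorm (v : K) at hcon
          have hvK : (v : K) ≠ 0 := fun h0 => hv (Subtype.ext h0)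
          refine hz ?_
          have hle : Knorm ((algebraMap k (Kn n) z * v⁻¹ : Kn n) : K) ≤ ρ := by
            refine le_of_mul_le_mul_right ?_ (hT.pos _ hvK)
            rw [← hT.mul]
            have : ((algebraMap k (Kn n) z * v⁻¹ : Kn n) : K) * v = algebraMap k K z :=
              inv_mul_cancel_right₀ hvK _
            rw [this]
            exact hcon.le
          have := h (algebraMap k (Kn n) z * v⁻¹) hle
          rwa [inv_mul_cancel_right₀ hv, Algebra.trace_algebraMap, nsmul_eq_mul,
            inv_mul_cancel_left₀ (Nat.cast_ne_zero.2 finrank_pos.ne')] at this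
      pair_eq_one_left := fun v => by
        obtain ⟨ε, hε, h⟩ := hsmall n v
        exact ⟨ε, hε, fun a ha => by rw [mul_comm a v]; exact h a ha⟩
      pair_eq_one_right := hsmall n
      exists_cover := hT.exists_cover n }

theorem statement_14
    (p : ℕ) [Fact (Nat.Prime p)]
    (k : Type) [Field k] [Algebra ℚ_[p] k] [FiniteDimensional ℚ_[p] k]
    (K : Type) [Field K] [Algebra k K] [CharZero K]
    (Kn : ℕ → IntermediateField k K)
    (hbot : Kn 1 = ⊥) (hmono : Monotone Kn)
    [hfd : ∀ n, FiniteDimensional k (Kn n)]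
    (hunion : ∀ x : K, ∃ n, x ∈ Kn n)
    (T : ℕ → K →ₗ[k] K)
    (hTmem : ∀ (n : ℕ) (x : K), T n x ∈ Kn n)
    (hTdef : ∀ (n ν : ℕ) (h : n ≤ ν) (x : K) (hx : x ∈ Kn ν),
      T n x = ((finrank k (Kn n) : K) / (finrank k (Kn ν) : K)) *
        (relTrace k K (Kn n) (Kn ν) (hmono h) ⟨x, hx⟩ : K))
    (Knorm : K → ℝ)
    (hKnorm : ∀ (n : ℕ) (x : K) (hx : x ∈ Kn n),
      Knorm x = absk p k (Algebra.norm k (⟨x, hx⟩ : Kn n)) ^ ((finrank k (Kn n) : ℝ)⁻¹))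
    (pairing : K → ProjLim k K Kn T → k)
    (hpair : ∀ (n : ℕ) (a : K) (ha : a ∈ Kn n) (x : ProjLim k K Kn T),
      pairing a x = (finrank k (Kn n) : k)⁻¹ *
        Algebra.trace k (Kn n) (⟨a * x.1 n, mul_mem ha (x.2.1 n)⟩ : Kn n))
    (q : ℕ → ℕ)
    (hq : ∀ n : ℕ, IsGreatest
      {r : ℝ | (∃ x : Kn n, Knorm ↑x ^ (finrank k (Kn n) : ℝ) = r) ∧ r < 1} ((q n : ℝ)⁻¹))
    (χ : k → ℂ)
    (hχadd : ∀ x y : k, χ (x + y) = χ x * χ y)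
    (hχnorm : ∀ x : k, ‖χ x‖ = 1)
    (hχcont : @Continuous _ _ (kTop p k) _ χ)
    (hχtriv : ∀ x : k, absk p k x ≤ 1 → χ x = 1)
    (hχrank : ∃ x : k, absk p k x ≤ (q 1 : ℝ) ∧ χ x ≠ 1)
    (μ : @MeasureTheory.Measure (ProjLim k K Kn T) (projMeas k K Kn T Knorm))
    (hμprob : MeasureTheory.IsProbabilityMeasure μ)
    (hμradon : ∀ A : Set (ProjLim k K Kn T), MeasurableSet[projMeas k K Kn T Knorm] A →
      μ A = ⨆ (C : Set (ProjLim k K Kn T))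
        (_ : C ⊆ A ∧ @IsCompact _ (projTop k K Kn T Knorm) C), μ C)
    (hμchar : ∀ a : K, ∫ x, χ (pairing a x) ∂μ = if Knorm a ≤ 1 then (1 : ℂ) else 0)
    (n : ℕ) (hn : 1 ≤ n) (F : K → ℂ) :
    (∃ φ : Kn n → ℂ, IsTestFun k K Kn Knorm n φ ∧
        ∀ ξ : K, F ξ = ∫ x, χ (pairing ξ x) * φ ⟨x.1 n, x.2.1 n⟩ ∂μ) ↔
      ((∀ ν : ℕ, n ≤ ν → IsTestFun k K Kn Knorm ν (fun ξ : Kn ν => F ↑ξ)) ∧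
       (∀ ξ ξ' : K, Knorm ξ' ≤ 1 → F (ξ + ξ') = F ξ) ∧
       (∀ ξ : K, (1 < ⨅ η : Kn n, Knorm (ξ - ↑η)) → F ξ = 0)) := by
  let _ := projMeas k K Kn T Knorm
  have : IsProbabilityMeasure μ := hμprob
  have hT := towerNorm_of_eq p k K Kn hunion Knorm hKnorm
  obtain ⟨z, -, hz⟩ := hχrank
  have hS := characterSystem_projLim p k K Kn hunion hmono T Knorm hT pairing hpair χ hχadd
    hχnorm hχtriv hz μ hμchar n
  simp only [isTestFun_iff k K Kn hT.zero hT.add_le]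
  constructor
  · rintro ⟨φ, ⟨hloc, ρ, hρ⟩, hF⟩
    obtain ⟨⟨δ, hδ, hunif⟩, C, hC⟩ := hT.uniform n φ hloc ρ hρ
    have hφint : Integrable (fun x : ProjLim k K Kn T => φ ⟨x.1 n, x.2.1 n⟩) μ := by
      refine Integrable.of_bound (Measurable.aestronglyMeasurable ?_) C
        (Filter.Eventually.of_forall fun x => hC _)
      exact measurable_of_locally_eq k K Kn T hT.zero n fun x =>
        ⟨δ, hδ, fun y hy => hunif ⟨x.1 n, x.2.1 n⟩ ⟨y.1 n, y.2.1 n⟩ hy⟩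
    obtain ⟨Q, _, r, c, hrc⟩ := hS.exists_integral_eq_sum hφint hδ hunif
    have hsum : ∀ ξ, F ξ = ∑ q, c q * if Knorm (ξ + r q) ≤ 1 then 1 else 0 := fun ξ =>
      (hF ξ).trans (hrc ξ)
    have hinv : ∀ ξ ξ' : K, Knorm ξ' ≤ 1 → F (ξ + ξ') = F ξ := by
      intro ξ ξ' hξ'
      have hiff : ∀ q, Knorm (ξ + ξ' + r q) ≤ 1 ↔ Knorm (ξ + r q) ≤ 1 := fun q => by
        constructor <;> intro h
        · have := (hS.norm_sub_le _ _).trans (max_le h hξ')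
          rwa [add_right_comm, add_sub_cancel_right] at this
        · have := (hT.add_le _ _).trans (max_le h hξ')
          rwa [add_right_comm] at this
      simp only [hsum, hiff]
    refine ⟨fun ν _ => ⟨fun x => ⟨1, one_pos, fun y hy => ?_⟩, ?_⟩, hinv, fun ξ hξ => ?_⟩
    · rw [← hinv x _ hy.le, add_sub_cancel]
    · refine ⟨max 1 (∑ q, Knorm (r q)), fun ξ hξ => ?_⟩
      rw [hsum]
      refine Finset.sum_eq_zero fun q _ => ?_
      rw [if_neg, mul_zero]
      intro hle
      have hq : Knorm (r q) ≤ ∑ q, Knorm (r q) :=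
        Finset.single_le_sum (f := fun q => Knorm (r q)) (fun q _ => hS.norm_nonneg _)
          (Finset.mem_univ q)
      have := (hS.norm_sub_le _ _).trans (max_le_max hle hq)
      rw [add_sub_cancel_right] at this
      exact this.not_gt hξ
    · rw [hsum]
      refine Finset.sum_eq_zero fun q _ => ?_
      rw [if_neg, mul_zero]
      refine not_le.2 (hξ.trans_le ?_)
      have hbdd : BddBelow (Set.range fun η : Kn n => Knorm (ξ - η)) :=
        ⟨0, by rintro _ ⟨η, rfl⟩; exact hS.norm_nonneg _⟩
      refine (ciInf_le hbdd (-r q)).trans_eq ?_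
      congr 1
      push_cast
      ring
  · rintro ⟨htest, hinv, hdist⟩
    obtain ⟨-, ρ, hρ⟩ := htest n le_rfl
    obtain ⟨φ, hloc, hsupp, hF⟩ := hS.exists_eq_integral hinv hρ fun ξ hξ => by
      refine hdist ξ ?_
      obtain ⟨i, hi⟩ := hunion ξ
      obtain ⟨c, hc1, hc⟩ := hT.gap (max i n)
      refine hc1.trans_le (le_ciInf fun η => ?_)
      exact hc ⟨ξ - η, sub_mem (hmono (le_max_left i n) hi) (hmono (le_max_right i n) η.2)⟩ (hξ η)
    exact ⟨φ, ⟨hloc, _, hsupp⟩, hF⟩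
end
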